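/- General decisiveness criterion: let (S, Σ, κ) be a stochastic transition system and B ∈ Σ. Suppose there exist finitely many finite sequences 𝒜_j = (A^{(j)}_0,…,A^{(j)}_{n_j}) of measurable subsets of S, for 0 ≤ j < m, and a real number p > 0 such that: (i) for every initial distribution μ on S, P_μ(⋃_{0≤j<m} GF φ_{𝒜_j}) = 1; and (ii) for every 0 ≤ j < m, writing 𝒜_j' for the sequence A^{(j)}_0,…,A^{(j)}_{n_j−1}, A^{(j)}_{n_j} ∩ (S∖B̃), every initial distribution ν for which ν_{𝒜_j'} is well-defined satisfies P_{ν_{𝒜_j'}}(F B) ≥ p. Then the STS is decisive with respect to B. -/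

import Mathlib

open MeasureTheory ProbabilityTheory Filter Set Topology

/-- Prepend one state to an infinite run. -/
def prep {S : Type*} (s : S) (ρ : ℕ → S) : ℕ → S
  | 0 => s
  | n + 1 => ρ n

/-- Prepend a finite word to an infinite run. -/
def prepList {S : Type*} (l : List S) (ρ : ℕ → S) : ℕ → S := fun n =>
  if h : n < l.length then l.get ⟨n, h⟩ else ρ (n - l.length)

/-- `E` is a tail event: membership is not affected by changing a finite prefix. -/
def IsTailEvent {S : Type*} (E : Set (ℕ → S)) : Prop :=
  ∀ (l : List S) (ρ : ℕ → S), ρ ∈ E ↔ prepList l ρ ∈ E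

/-- Cylinder `Cyl A n = {ρ | ρ k ∈ A k for all k < n}` (built from `A 0, …, A (n-1)`). -/
def Cyl {S : Type*} (A : ℕ → Set S) (n : ℕ) : Set (ℕ → S) := {ρ | ∀ k < n, ρ k ∈ A k}

/-- Event `F B`: eventually reach `B`. -/
def FEv {S : Type*} (B : Set S) : Set (ℕ → S) := {ρ | ∃ n, ρ n ∈ B}

/-- Event `F^{≤ m} B`: reach `B` within `m` steps. -/
def FleEv {S : Type*} (m : ℕ) (B : Set S) : Set (ℕ → S) := {ρ | ∃ n ≤ m, ρ n ∈ B}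

/-- Event `G B`: always in `B`. -/
def GEv {S : Type*} (B : Set S) : Set (ℕ → S) := {ρ | ∀ n, ρ n ∈ B}

/-- Event `GF B`: visit `B` infinitely often. -/
def GFEv {S : Type*} (B : Set S) : Set (ℕ → S) := {ρ | ∀ i, ∃ j ≥ i, ρ j ∈ B}

/-- Event `FG B`: eventually always in `B`. -/
def FGEv {S : Type*} (B : Set S) : Set (ℕ → S) := {ρ | ∃ i, ∀ j ≥ i, ρ j ∈ B}

/-- Event `GF φ_𝒜`: the pattern `A 0, …, A n` occurs at infinitely many positions. -/
def GFPat {S : Type*} (A : ℕ → Set S) (n : ℕ) : Set (ℕ → S) :=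
  {ρ | ∀ i, ∃ j ≥ i, ∀ k ≤ n, ρ (j + k) ∈ A k}

/-- Event `A U B`. -/
def UntilEv {S : Type*} (A B : Set S) : Set (ℕ → S) :=
  {ρ | ∃ n, ρ n ∈ B ∧ ∀ k < n, ρ k ∈ A}

/-- Event `A U^{≤ m} B`. -/
def UntilLeEv {S : Type*} (m : ℕ) (A B : Set S) : Set (ℕ → S) :=
  {ρ | ∃ n ≤ m, ρ n ∈ B ∧ ∀ k < n, ρ k ∈ A}

/-- The filtration `F n`: σ-algebra generated by the cylinders of length `n`,
i.e., by the first `n` coordinates. -/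
def cylFiltration (S : Type*) [MeasurableSpace S] (n : ℕ) : MeasurableSpace (ℕ → S) :=
  MeasurableSpace.comap (fun ρ (i : Fin n) => ρ i) inferInstance

/-- `P` is the family of path measures of the STS `(S, Σ, κ)` given by the
Ionescu–Tulcea construction: for every initial probability distribution `μ`,
`P μ` is a probability measure on runs, and `P` satisfies the Markov property
(`s₀ ∼ μ`, and the rest of the run follows the chain started in `κ s₀`),
which uniquely characterizes the Ionescu–Tulcea path measures. -/
def IsPathMeasure {S : Type*} [MeasurableSpace S] (κ : Kernel S S)
    (P : Measure S → Measure (ℕ → S)) : Prop :=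
  (∀ μ : Measure S, IsProbabilityMeasure μ → IsProbabilityMeasure (P μ)) ∧
  (∀ μ : Measure S, IsProbabilityMeasure μ →
    P μ = μ.bind fun s => (P (κ s)).map (prep s))

/-- `B̃`: the set of states from which `B` is reached with probability zero. -/
def Btilde {S : Type*} [MeasurableSpace S] (P : Measure S → Measure (ℕ → S)) (B : Set S) :
    Set S := {s | P (Measure.dirac s) (FEv B) = 0}

/-- The STS with path measures `P` is decisive w.r.t. `B`. -/
def Decisive {S : Type*} [MeasurableSpace S] (P : Measure S → Measure (ℕ → S)) (B : Set S) :
    Prop := ∀ μ : Measure S, IsProbabilityMeasure μ → P μ (FEv B ∪ FEv (Btilde P B)) = 1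

/-- `ν_{A₀,…,Aₙ}`: the distribution of the `n`-th state under `P ν` conditioned on
the cylinder `Cyl A (n+1)`. -/
noncomputable def condDist {S : Type*} [MeasurableSpace S]
    (P : Measure S → Measure (ℕ → S)) (ν : Measure S) (A : ℕ → Set S) (n : ℕ) : Measure S :=
  (ProbabilityTheory.cond (P ν) (Cyl A (n + 1))).map fun ρ => ρ n

/-- The run started at time `t`. -/
def shiftRun {S : Type*} (t : ℕ) (ρ : ℕ → S) : ℕ → S := fun k => ρ (t + k)

lemma prep_preimage_Cyl_succ {S : Type*} (s : S) (A : ℕ → Set S) (n : ℕ) :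
    prep s ⁻¹' Cyl A (n + 1) = {_ρ | s ∈ A 0} ∩ Cyl (fun k => A (k + 1)) n := by
  ext ρ
  constructor
  · intro h
    exact ⟨h 0 (Nat.succ_pos n), fun k hk => h (k + 1) (Nat.succ_lt_succ hk)⟩
  · rintro ⟨h0, h⟩ (_ | k) hk
    · exact h0
    · exact h k (Nat.lt_of_succ_lt_succ hk)

section Paths

variable {S : Type*} [MeasurableSpace S]

lemma measurable_shiftRun (t : ℕ) : Measurable (shiftRun t : (ℕ → S) → ℕ → S) :=
  measurable_pi_lambda _ fun k => measurable_pi_apply (t + k)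

lemma measurable_prep (s : S) : Measurable (prep s) := by
  refine measurable_pi_lambda _ fun k => ?_
  cases k with
  | zero => exact measurable_const
  | succ k => exact measurable_pi_apply k

lemma measurableSet_Cyl {A : ℕ → Set S} {n : ℕ} (hA : ∀ k < n, MeasurableSet (A k)) :
    MeasurableSet (Cyl A n) := by
  have : Cyl A n = ⋂ k, ⋂ (_ : k < n), (fun ρ : ℕ → S => ρ k) ⁻¹' A k := by
    ext ρ; simp [Cyl]
  rw [this]
  exact MeasurableSet.iInter fun k => MeasurableSet.iInter fun hk =>
    measurable_pi_apply k (hA k hk)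

lemma measurableSet_FEv {B : Set S} (hB : MeasurableSet B) : MeasurableSet (FEv B) := by
  have : FEv B = ⋃ k, (fun ρ : ℕ → S => ρ k) ⁻¹' B := by ext ρ; simp [FEv]
  rw [this]
  exact MeasurableSet.iUnion fun k => measurable_pi_apply k hB

lemma measurableSet_GFPat {A : ℕ → Set S} {n : ℕ} (hA : ∀ k ≤ n, MeasurableSet (A k)) :
    MeasurableSet (GFPat A n) := by
  have : GFPat A n = ⋂ i, ⋃ j, ⋃ (_ : j ≥ i), ⋂ k, ⋂ (_ : k ≤ n),
      (fun ρ : ℕ → S => ρ (j + k)) ⁻¹' A k := by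
    ext ρ; simp [GFPat]
  rw [this]
  exact MeasurableSet.iInter fun i => MeasurableSet.iUnion fun j => MeasurableSet.iUnion fun _ =>
    MeasurableSet.iInter fun k => MeasurableSet.iInter fun hk =>
      measurable_pi_apply (j + k) (hA k hk)

lemma exists_Cyl_eq_of_mem_squareCylinders {E : Set (ℕ → S)}
    (hE : E ∈ squareCylinders fun _ : ℕ => {A : Set S | MeasurableSet A}) :
    ∃ A : ℕ → Set S, ∃ n, (∀ k, MeasurableSet (A k)) ∧ E = Cyl A n := by
  classical
  obtain ⟨I, A, hA, rfl⟩ := hE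
  refine ⟨fun k => if k ∈ I then A k else univ, I.sup id + 1, fun k => ?_, ?_⟩
  · dsimp only
    split_ifs
    · exact hA k (mem_univ k)
    · exact MeasurableSet.univ
  · ext ρ
    constructor
    · intro h k _
      dsimp only
      split_ifs with hk
      · exact h k hk
      · trivial
    · intro h k hk
      have hk' : k ∈ I := hk
      have := h k (Nat.lt_succ_of_le (Finset.le_sup (f := id) hk'))
      simpa [hk'] using this

lemma mem_of_measurableSet_piLE {t : ℕ} {A : Set (ℕ → S)}
    (hA : MeasurableSet[Filtration.piLE (X := fun _ : ℕ => S) t] A)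
    {ρ ρ' : ℕ → S} (h : ∀ k ≤ t, ρ k = ρ' k) (hρ : ρ ∈ A) : ρ' ∈ A := by
  obtain ⟨A', -, rfl⟩ := hA
  have : Preorder.restrictLe t ρ = Preorder.restrictLe (π := fun _ : ℕ => S) t ρ' := by
    ext k; exact h k k.2
  rw [mem_preimage, ← this]
  exact hρ

lemma measurable_piLE_eval {k t : ℕ} (hk : k ≤ t) :
    Measurable[Filtration.piLE (X := fun _ : ℕ => S) t] fun ρ : ℕ → S => ρ k :=
  fun A hA => ⟨(fun f => f ⟨k, hk⟩) ⁻¹' A, measurable_pi_apply (⟨k, hk⟩ : Iic t) hA, rfl⟩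

lemma measurable_piLE_shiftRun {n t u : ℕ} (h : t + n ≤ u) :
    Measurable[Filtration.piLE (X := fun _ : ℕ => S) u,
      Filtration.piLE (X := fun _ : ℕ => S) n] (shiftRun t : (ℕ → S) → ℕ → S) := by
  rintro _ ⟨E, hE, rfl⟩
  have hcomp : Measurable[Filtration.piLE (X := fun _ : ℕ => S) u]
      fun ρ : ℕ → S => Preorder.restrictLe (π := fun _ : ℕ => S) n (shiftRun t ρ) :=
    @measurable_pi_lambda _ _ _ (Filtration.piLE (X := fun _ : ℕ => S) u) _ _
      fun k => measurable_piLE_eval ((Nat.add_le_add_left k.2 t).trans h)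
  exact hcomp hE

lemma measurableSet_piLE_Cyl {A : ℕ → Set S} {n : ℕ} (hA : ∀ k ≤ n, MeasurableSet (A k)) :
    MeasurableSet[Filtration.piLE (X := fun _ : ℕ => S) n] (Cyl A (n + 1)) := by
  have : Cyl A (n + 1) = ⋂ k, ⋂ (_ : k ≤ n), (fun ρ : ℕ → S => ρ k) ⁻¹' A k := by
    ext ρ; simp [Cyl]
  rw [this]
  exact MeasurableSet.iInter fun k => MeasurableSet.iInter fun hk =>
    measurable_piLE_eval hk (hA k hk)

end Paths

lemma exists_frequently_mul_add {N : ℕ} (hN : 0 < N) {q : ℕ → Prop} (h : ∃ᶠ t in atTop, q t) :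
    ∃ r < N, ∃ᶠ k in atTop, q (N * k + r) := by
  by_contra! hc
  have hc' : ∀ᶠ k in atTop, ∀ r ∈ Finset.range N, ¬ q (N * k + r) := by
    rw [Filter.eventually_all_finset]
    intro r hr
    exact hc r (Finset.mem_range.1 hr)
  have hdiv : Tendsto (fun t => t / N) atTop atTop := Nat.tendsto_div_const_atTop hN.ne'
  refine h ((hdiv.eventually hc').mono fun t ht => ?_)
  have := ht (t % N) (Finset.mem_range.2 (Nat.mod_lt t hN))
  rwa [Nat.div_add_mod] at this

namespace IsPathMeasure

variable {S : Type*} [MeasurableSpace S] {κ : Kernel S S} [IsMarkovKernel κ]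
  {P : Measure S → Measure (ℕ → S)}

lemma isProbabilityMeasure_map_prep (hP : IsPathMeasure κ P) (s : S) :
    IsProbabilityMeasure ((P (κ s)).map (prep s)) := by
  have := hP.1 (κ s) inferInstance
  exact Measure.isProbabilityMeasure_map (measurable_prep s).aemeasurable

lemma aemeasurable_map_prep (hP : IsPathMeasure κ P) (μ : Measure S) [IsProbabilityMeasure μ] :
    AEMeasurable (fun s => (P (κ s)).map (prep s)) μ := by
  by_contra h
  have hprob := hP.1 μ inferInstance
  rw [hP.2 μ inferInstance, Measure.bind, Measure.map_of_not_aemeasurable h,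
    Measure.join_zero] at hprob
  exact hprob.ne_zero _ rfl

lemma measurable_map_prep_Cyl (hP : IsPathMeasure κ P) (n : ℕ) (A : ℕ → Set S)
    (hA : ∀ k, MeasurableSet (A k)) :
    Measurable fun s => (P (κ s)).map (prep s) (Cyl A n) := by
  induction n generalizing A with
  | zero =>
    have huniv : Cyl A 0 = univ := by ext; simp [Cyl]
    have (s : S) : (P (κ s)).map (prep s) (Cyl A 0) = 1 := by
      have := hP.isProbabilityMeasure_map_prep s
      rw [huniv, measure_univ]
    simp only [this, measurable_const]
  | succ n ih =>
    have key (s : S) : (P (κ s)).map (prep s) (Cyl A (n + 1)) =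
        (A 0).indicator (fun s => ∫⁻ s', (P (κ s')).map (prep s')
          (Cyl (fun k => A (k + 1)) n) ∂κ s) s := by
      have hC := measurableSet_Cyl (n := n) fun k _ => hA (k + 1)
      rw [Measure.map_apply (measurable_prep s) (measurableSet_Cyl fun k _ => hA k),
        prep_preimage_Cyl_succ]
      by_cases hs : s ∈ A 0
      · have hu : {_ρ : ℕ → S | s ∈ A 0} = univ := by simp [hs]
        rw [hu, univ_inter, indicator_of_mem hs, hP.2 (κ s) inferInstance,
          Measure.bind_apply hC (hP.aemeasurable_map_prep _)]
      · have hu : {_ρ : ℕ → S | s ∈ A 0} = ∅ := by simp [hs]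
        rw [hu, empty_inter, indicator_of_notMem hs, measure_empty]
    simp only [key]
    exact (ih _ fun k => hA (k + 1)).lintegral_kernel.indicator (hA 0)

lemma measurable_map_prep (hP : IsPathMeasure κ P) :
    Measurable fun s => (P (κ s)).map (prep s) := by
  have := hP.isProbabilityMeasure_map_prep
  refine Measurable.measure_of_isPiSystem_of_isProbabilityMeasure
    generateFrom_squareCylinders.symm
    (isPiSystem_squareCylinders (fun _ => MeasurableSpace.isPiSystem_measurableSet)
      fun _ => MeasurableSet.univ) ?_
  intro E hE
  obtain ⟨A, n, hA, rfl⟩ := exists_Cyl_eq_of_mem_squareCylinders hE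
  exact hP.measurable_map_prep_Cyl n A hA

lemma apply_dirac (hP : IsPathMeasure κ P) (s : S) :
    P (Measure.dirac s) = (P (κ s)).map (prep s) := by
  rw [hP.2 _ inferInstance, Measure.dirac_bind hP.measurable_map_prep]

lemma measurable_apply_dirac (hP : IsPathMeasure κ P) :
    Measurable fun s => P (Measure.dirac s) := by
  simpa only [hP.apply_dirac] using hP.measurable_map_prep

lemma measurable_apply_dirac_apply (hP : IsPathMeasure κ P) {E : Set (ℕ → S)}
    (hE : MeasurableSet E) : Measurable fun s => P (Measure.dirac s) E :=
  (Measure.measurable_coe hE).comp hP.measurable_apply_dirac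

lemma eq_bind_dirac (hP : IsPathMeasure κ P) (μ : Measure S) [IsProbabilityMeasure μ] :
    P μ = μ.bind fun s => P (Measure.dirac s) := by
  simpa only [hP.apply_dirac] using hP.2 μ inferInstance

lemma measurableSet_Btilde (hP : IsPathMeasure κ P) {B : Set S} (hB : MeasurableSet B) :
    MeasurableSet (Btilde P B) :=
  hP.measurable_apply_dirac_apply (measurableSet_FEv hB) (measurableSet_singleton 0)

lemma measure_inter_shiftRun_of_dirac (hP : IsPathMeasure κ P) {E : Set (ℕ → S)}
    (hE : MeasurableSet E) (t : ℕ) (μ : Measure S) [IsProbabilityMeasure μ] {A : Set (ℕ → S)}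
    (hA : MeasurableSet A)
    (h : ∀ s, P (Measure.dirac s) (A ∩ shiftRun t ⁻¹' E) =
      ∫⁻ ρ in A, P (Measure.dirac (ρ t)) E ∂P (Measure.dirac s)) :
    P μ (A ∩ shiftRun t ⁻¹' E) = ∫⁻ ρ in A, P (Measure.dirac (ρ t)) E ∂P μ := by
  have hmeas : Measurable fun ρ : ℕ → S => P (Measure.dirac (ρ t)) E :=
    (hP.measurable_apply_dirac_apply hE).comp (measurable_pi_apply t)
  rw [← lintegral_indicator hA, hP.eq_bind_dirac μ,
    Measure.bind_apply (hA.inter (measurable_shiftRun t hE))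
      hP.measurable_apply_dirac.aemeasurable,
    Measure.lintegral_bind hP.measurable_apply_dirac.aemeasurable
      (hmeas.indicator hA).aemeasurable]
  simp only [h, lintegral_indicator hA]

/-- Markov property at a deterministic time, for events depending on the coordinates `≤ t`. -/
lemma measure_inter_shiftRun (hP : IsPathMeasure κ P) {E : Set (ℕ → S)} (hE : MeasurableSet E)
    (t : ℕ) (μ : Measure S) [IsProbabilityMeasure μ] {A : Set (ℕ → S)} (hA : MeasurableSet A)
    (hdep : ∀ ρ ρ' : ℕ → S, (∀ k ≤ t, ρ k = ρ' k) → ρ ∈ A → ρ' ∈ A) :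
    P μ (A ∩ shiftRun t ⁻¹' E) = ∫⁻ ρ in A, P (Measure.dirac (ρ t)) E ∂P μ := by
  refine hP.measure_inter_shiftRun_of_dirac hE t μ hA fun s => ?_
  have hmeas (t : ℕ) : Measurable fun ρ : ℕ → S => P (Measure.dirac (ρ t)) E :=
    (hP.measurable_apply_dirac_apply hE).comp (measurable_pi_apply t)
  induction t generalizing A s with
  | zero =>
    have hshift : shiftRun 0 ⁻¹' E = E := by
      have : (shiftRun 0 : (ℕ → S) → ℕ → S) = id := by
        funext ρ k
        simp [shiftRun]
      rw [this, preimage_id]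
    have hprob := hP.1 (κ s) inferInstance
    rw [hshift, hP.apply_dirac s, setLIntegral_map hA (hmeas 0) (measurable_prep s),
      Measure.map_apply (measurable_prep s) (hA.inter hE), preimage_inter]
    simp only [prep, hP.apply_dirac s, Measure.map_apply (measurable_prep s) hE]
    rcases (prep s ⁻¹' A).eq_empty_or_nonempty with h | ⟨ρ₀, hρ₀⟩
    · simp [h]
    · have : prep s ⁻¹' A = univ := by
        refine eq_univ_of_forall fun ρ => hdep _ _ (fun k hk => ?_) hρ₀
        rw [Nat.le_zero.1 hk]
        rfl
      simp [this]
  | succ t ih =>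
    have hA' := measurable_prep s hA
    have hshift : prep s ⁻¹' (shiftRun (t + 1) ⁻¹' E) = shiftRun t ⁻¹' E := by
      have : (fun ρ => shiftRun (t + 1) (prep s ρ)) = shiftRun t := by
        funext ρ k
        simp only [shiftRun, Nat.add_right_comm t 1 k, prep]
      rw [← preimage_comp, Function.comp_def, this]
    rw [hP.apply_dirac s, setLIntegral_map hA (hmeas (t + 1)) (measurable_prep s),
      Measure.map_apply (measurable_prep s) (hA.inter (measurable_shiftRun (t + 1) hE)),
      preimage_inter, hshift]
    refine hP.measure_inter_shiftRun_of_dirac hE t (κ s) hA' fun s' => ?_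
    refine ih hA' (fun ρ ρ' h hρ => hdep _ _ (fun k hk => ?_) hρ) s'
    cases k with
    | zero => rfl
    | succ k => exact h k (Nat.le_of_succ_le_succ hk)

lemma condExp_shiftRun (hP : IsPathMeasure κ P) {E : Set (ℕ → S)} (hE : MeasurableSet E)
    (t : ℕ) (μ : Measure S) [IsProbabilityMeasure μ] :
    (P μ)[(shiftRun t ⁻¹' E).indicator (1 : (ℕ → S) → ℝ) |
      Filtration.piLE (X := fun _ : ℕ => S) t] =ᵐ[P μ]
      fun ρ => (P (Measure.dirac (ρ t)) E).toReal := by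
  have hprob := hP.1 μ inferInstance
  have hprob' (s : S) := hP.1 (Measure.dirac s) inferInstance
  have hm := (Filtration.piLE (X := fun _ : ℕ => S)).le t
  have hE' := measurable_shiftRun t hE
  have hmeas : Measurable fun s => (P (Measure.dirac s) E).toReal :=
    (hP.measurable_apply_dirac_apply hE).ennreal_toReal
  have hintg : Integrable (fun ρ : ℕ → S => (P (Measure.dirac (ρ t)) E).toReal) (P μ) := by
    refine Integrable.of_bound (hmeas.comp (measurable_pi_apply t)).aestronglyMeasurable 1
      (Eventually.of_forall fun ρ => ?_)
    rw [Real.norm_of_nonneg ENNReal.toReal_nonneg]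
    exact measureReal_le_one
  refine (ae_eq_condExp_of_forall_setIntegral_eq hm ?_ (fun _ _ _ => hintg.integrableOn) ?_
    (hmeas.comp (measurable_piLE_eval le_rfl)).aestronglyMeasurable).symm
  · exact (integrable_const (1 : ℝ)).indicator hE'
  · intro A hA _
    rw [integral_indicator_one hE', measureReal_restrict_apply hE', inter_comm, measureReal_def,
      hP.measure_inter_shiftRun hE t μ (hm A hA) fun _ _ => mem_of_measurableSet_piLE hA,
      integral_toReal]
    · exact ((hP.measurable_apply_dirac_apply hE).comp (measurable_pi_apply t)).aemeasurable
    · exact Eventually.of_forall fun ρ => measure_lt_top _ _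

/-- If `D` has conditional probability at least `c` times that of `C` from every state, then
almost surely `D` occurs infinitely often along a run as soon as `C` does. -/
lemma ae_frequently_shiftRun_mem (hP : IsPathMeasure κ P) (μ : Measure S)
    [IsProbabilityMeasure μ] {n : ℕ} {C D : Set (ℕ → S)}
    (hC : MeasurableSet[Filtration.piLE (X := fun _ : ℕ => S) n] C)
    (hD : MeasurableSet[Filtration.piLE (X := fun _ : ℕ => S) n] D) {c : ℝ} (hc : 0 < c)
    (hCD : ∀ s, ENNReal.ofReal c * P (Measure.dirac s) C ≤ P (Measure.dirac s) D) :
    ∀ᵐ ρ ∂P μ, (∃ᶠ t in atTop, shiftRun t ρ ∈ C) → ∃ᶠ t in atTop, shiftRun t ρ ∈ D := by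
  have hprob := hP.1 μ inferInstance
  have hprob' (s : S) := hP.1 (Measure.dirac s) inferInstance
  have hle := (Filtration.piLE (X := fun _ : ℕ => S)).le n
  have residue (r : ℕ) : ∀ᵐ ρ ∂P μ, (∃ᶠ k in atTop, shiftRun ((n + 1) * k + r) ρ ∈ C) →
      ∃ᶠ k in atTop, shiftRun ((n + 1) * k + r) ρ ∈ D := by
    let ℱ : @Filtration (ℕ → S) ℕ _ MeasurableSpace.pi :=
      { seq := fun k => Filtration.piLE (X := fun _ : ℕ => S) ((n + 1) * k + r)
        mono' := fun i j hij => (Filtration.piLE (X := fun _ : ℕ => S)).mono (by gcongr)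
        le' := fun i => (Filtration.piLE (X := fun _ : ℕ => S)).le _ }
    let ev (E : Set (ℕ → S)) (k : ℕ) : Set (ℕ → S) :=
      Nat.casesOn k ∅ fun k => shiftRun ((n + 1) * k + r) ⁻¹' E
    have hev {E : Set (ℕ → S)}
        (hE : MeasurableSet[Filtration.piLE (X := fun _ : ℕ => S) n] E) (k : ℕ) :
        MeasurableSet[ℱ k] (ev E k) := by
      cases k with
      | zero => exact @MeasurableSet.empty _ (ℱ 0)
      | succ k => exact measurable_piLE_shiftRun (by rw [Nat.mul_succ]; omega) hE
    have hlim (E : Set (ℕ → S)) (ρ : ℕ → S) : ρ ∈ limsup (ev E) atTop ↔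
        ∃ᶠ k in atTop, shiftRun ((n + 1) * k + r) ρ ∈ E := by
      rw [← limsup_nat_add (ev E) 1, mem_limsup_iff_frequently_mem]
      rfl
    have hcond {E : Set (ℕ → S)} (hE : MeasurableSet E) : ∀ᵐ ρ ∂P μ, ∀ k,
        ((P μ)[(ev E (k + 1)).indicator (1 : (ℕ → S) → ℝ) | ℱ k]) ρ =
          (P (Measure.dirac (ρ ((n + 1) * k + r))) E).toReal :=
      ae_all_iff.2 fun k => hP.condExp_shiftRun hE _ μ
    filter_upwards [ae_mem_limsup_atTop_iff (P μ) (hev hC), ae_mem_limsup_atTop_iff (P μ) (hev hD),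
      hcond (hle C hC), hcond (hle D hD)] with ρ hlC hlD hcC hcD
    rw [← hlim, ← hlim, hlC, hlD]
    simp only [hcC, hcD]
    intro h
    refine tendsto_atTop_mono (fun k => ?_) (h.const_mul_atTop hc)
    rw [Finset.mul_sum]
    refine Finset.sum_le_sum fun i _ => ?_
    have := ENNReal.toReal_mono (measure_ne_top _ _) (hCD (ρ ((n + 1) * i + r)))
    rwa [ENNReal.toReal_mul, ENNReal.toReal_ofReal hc.le] at this
  filter_upwards [ae_all_iff.2 residue] with ρ hρ hfreq
  obtain ⟨r, -, hr⟩ := exists_frequently_mul_add n.succ_pos hfreq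
  have htend : Tendsto (fun k => (n + 1) * k + r) atTop atTop :=
    tendsto_atTop_mono (fun k => (Nat.le_mul_of_pos_left k n.succ_pos).trans le_self_add) tendsto_id
  exact htend.frequently (hρ r hr)

/-- Almost surely, a run along which the probability of reaching `B` is infinitely often at least
`c > 0` reaches `B`. -/
lemma ae_mem_FEv_of_frequently (hP : IsPathMeasure κ P) (μ : Measure S)
    [IsProbabilityMeasure μ] {B : Set S} (hB : MeasurableSet B) {c : ℝ} (hc : 0 < c) :
    ∀ᵐ ρ ∂P μ, (∃ᶠ t in atTop, ENNReal.ofReal c ≤ P (Measure.dirac (ρ t)) (FEv B)) →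
      ρ ∈ FEv B := by
  have hprob := hP.1 μ inferInstance
  have hprob' (s : S) := hP.1 (Measure.dirac s) inferInstance
  have hF := measurableSet_FEv hB
  have hsub (t : ℕ) : shiftRun t ⁻¹' FEv B ⊆ FEv B := fun ρ ⟨k, hk⟩ => ⟨t + k, hk⟩
  have hintg {E : Set (ℕ → S)} (hE : MeasurableSet E) :
      Integrable (E.indicator (1 : (ℕ → S) → ℝ)) (P μ) :=
    (integrable_const (1 : ℝ)).indicator hE
  have hlevy := (hintg hF).tendsto_ae_condExp (ℱ := Filtration.piLE (X := fun _ : ℕ => S)) (by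
    refine stronglyMeasurable_one.indicator ?_
    have : FEv B = ⋃ k, (fun ρ : ℕ → S => ρ k) ⁻¹' B := by ext ρ; simp [FEv]
    rw [this]
    exact MeasurableSet.iUnion fun k =>
      le_iSup (fun t => Filtration.piLE (X := fun _ : ℕ => S) t) k _
        (measurable_piLE_eval le_rfl hB))
  have hmono : ∀ᵐ ρ ∂P μ, ∀ t, (P (Measure.dirac (ρ t)) (FEv B)).toReal ≤
      ((P μ)[(FEv B).indicator (1 : (ℕ → S) → ℝ) |
        Filtration.piLE (X := fun _ : ℕ => S) t]) ρ := by
    refine ae_all_iff.2 fun t => ?_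
    have h := condExp_mono (m := Filtration.piLE (X := fun _ : ℕ => S) t)
      (hintg (measurable_shiftRun t hF)) (hintg hF)
      (Eventually.of_forall (indicator_le_indicator_of_subset (hsub t) fun _ => zero_le_one))
    filter_upwards [h, hP.condExp_shiftRun hF t μ] with ρ h1 h2
    rwa [← h2]
  filter_upwards [hlevy, hmono] with ρ hlim hle hfreq
  by_contra hρ
  rw [indicator_of_notMem hρ] at hlim
  refine hfreq ((hlim.eventually_lt_const hc).mono fun t ht hct => ?_)
  have := (ENNReal.ofReal_le_iff_le_toReal (measure_ne_top _ _)).1 hct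
  linarith [hle t]

/-- If conditioning the chain started in `s` on the cylinder gives probability at least `p` of
reaching `B`, then at the end of the cylinder the reachability probability is at least `p / 2`
with conditional probability at least `p / 2`. -/
lemma ofReal_half_mul_Cyl_le (hP : IsPathMeasure κ P) {B : Set S} (hB : MeasurableSet B)
    {A : ℕ → Set S} {n : ℕ} (hA : ∀ k ≤ n, MeasurableSet (A k)) {p : ℝ} (hp : 0 < p) (s : S)
    (h : 0 < P (Measure.dirac s) (Cyl A (n + 1)) →
      ENNReal.ofReal p ≤ P (condDist P (Measure.dirac s) A n) (FEv B)) :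
    ENNReal.ofReal (p / 2) * P (Measure.dirac s) (Cyl A (n + 1)) ≤
      P (Measure.dirac s) (Cyl A (n + 1) ∩
        {ρ | ENNReal.ofReal (p / 2) ≤ P (Measure.dirac (ρ n)) (FEv B)}) := by
  set Q := P (Measure.dirac s)
  set C := Cyl A (n + 1)
  set U : Set (ℕ → S) := {ρ | ENNReal.ofReal (p / 2) ≤ P (Measure.dirac (ρ n)) (FEv B)}
  have hprob : IsProbabilityMeasure Q := hP.1 _ inferInstance
  have hprob' (s : S) := hP.1 (Measure.dirac s) inferInstance
  rcases eq_or_ne (Q C) 0 with h0 | h0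
  · simp [h0]
  have hC : MeasurableSet C := measurableSet_Cyl fun k hk => hA k (Nat.lt_succ_iff.1 hk)
  have hF := measurableSet_FEv hB
  have hreach := hP.measurable_apply_dirac_apply hF
  have hreachn : Measurable fun ρ : ℕ → S => P (Measure.dirac (ρ n)) (FEv B) :=
    hreach.comp (measurable_pi_apply n)
  have hUm : MeasurableSet U := measurableSet_le measurable_const hreachn
  have hp2 : ENNReal.ofReal p = ENNReal.ofReal (p / 2) + ENNReal.ofReal (p / 2) := by
    rw [← ENNReal.ofReal_add (by positivity) (by positivity), add_halves]
  have hlow : ENNReal.ofReal p * Q C ≤ ∫⁻ ρ in C, P (Measure.dirac (ρ n)) (FEv B) ∂Q := by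
    have hcond : IsProbabilityMeasure (ProbabilityTheory.cond Q C) :=
      cond_isProbabilityMeasure h0
    have hdist : IsProbabilityMeasure (condDist P (Measure.dirac s) A n) :=
      Measure.isProbabilityMeasure_map (measurable_pi_apply n).aemeasurable
    have h' := h (pos_iff_ne_zero.2 h0)
    rw [hP.eq_bind_dirac (condDist P (Measure.dirac s) A n),
      Measure.bind_apply hF hP.measurable_apply_dirac.aemeasurable, condDist,
      lintegral_map hreach (measurable_pi_apply n), ProbabilityTheory.cond,
      lintegral_smul_measure, smul_eq_mul] at h'
    calc ENNReal.ofReal p * Q C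
        ≤ ((Q C)⁻¹ * ∫⁻ ρ in C, P (Measure.dirac (ρ n)) (FEv B) ∂Q) * Q C := by gcongr
      _ = ∫⁻ ρ in C, P (Measure.dirac (ρ n)) (FEv B) ∂Q := by
        rw [mul_comm, ← mul_assoc, ENNReal.mul_inv_cancel h0 (measure_ne_top _ _), one_mul]
  have hupp : ∫⁻ ρ in C, P (Measure.dirac (ρ n)) (FEv B) ∂Q ≤
      ENNReal.ofReal (p / 2) * Q C + Q (C ∩ U) := by
    calc ∫⁻ ρ in C, P (Measure.dirac (ρ n)) (FEv B) ∂Q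
        ≤ ∫⁻ ρ in C, (ENNReal.ofReal (p / 2) + U.indicator 1 ρ) ∂Q := by
          refine lintegral_mono fun ρ => ?_
          by_cases hρ : ρ ∈ U
          · rw [indicator_of_mem hρ]
            exact prob_le_one.trans le_add_self
          · exact (le_of_lt (not_le.1 hρ)).trans le_self_add
      _ = ENNReal.ofReal (p / 2) * Q C + Q (C ∩ U) := by
          rw [lintegral_add_left measurable_const, setLIntegral_const,
            lintegral_indicator_one hUm, Measure.restrict_apply hUm, inter_comm]
  have := hlow.trans hupp
  rw [hp2, add_mul] at this
  exact (ENNReal.add_le_add_iff_left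
    (ENNReal.mul_ne_top ENNReal.ofReal_ne_top (measure_ne_top _ _))).1 this

end IsPathMeasure

/-- **General decisiveness criterion.** Suppose there are finitely many finite sequences
`𝒜 j = (𝒜 j 0, …, 𝒜 j (n j))` of measurable sets (`0 ≤ j < m`) and `p > 0` such that:
(i) every run almost surely sees some pattern `𝒜 j` infinitely often, and
(ii) for every `j`, writing `𝒜' j` for the sequence `𝒜 j` whose last set is intersected
with `(S ∖ B̃)`, every initial distribution `ν` for which `ν_{𝒜' j}` is well-defined
satisfies `P_{ν_{𝒜' j}}(F B) ≥ p`.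
Then the STS is decisive with respect to `B`. -/
theorem general_decisiveness_criterion
    {S : Type*} [MeasurableSpace S] (κ : Kernel S S) [IsMarkovKernel κ]
    (P : Measure S → Measure (ℕ → S)) (hP : IsPathMeasure κ P)
    (B : Set S) (hB : MeasurableSet B)
    (m : ℕ) (𝒜 : Fin m → ℕ → Set S) (n : Fin m → ℕ)
    (h𝒜 : ∀ (j : Fin m), ∀ k ≤ n j, MeasurableSet (𝒜 j k))
    (p : ℝ) (hp : 0 < p)
    (h1 : ∀ μ : Measure S, IsProbabilityMeasure μ →
      P μ (⋃ j : Fin m, GFPat (𝒜 j) (n j)) = 1)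
    (h2 : ∀ j : Fin m, ∀ ν : Measure S, IsProbabilityMeasure ν →
      0 < P ν (Cyl (fun k => if k = n j then 𝒜 j k ∩ (Btilde P B)ᶜ else 𝒜 j k) (n j + 1)) →
      ENNReal.ofReal p ≤
        P (condDist P ν (fun k => if k = n j then 𝒜 j k ∩ (Btilde P B)ᶜ else 𝒜 j k) (n j))
          (FEv B)) :
    Decisive P B := by
  intro μ hμ
  have hprob := hP.1 μ hμ
  have hBt := hP.measurableSet_Btilde hB
  have hF := (measurableSet_FEv hB).union (measurableSet_FEv hBt)
  rw [← prob_compl_eq_zero_iff hF, ← mem_ae_iff]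
  have hA (j : Fin m) (k : ℕ) (hk : k ≤ n j) :
      MeasurableSet (if k = n j then 𝒜 j k ∩ (Btilde P B)ᶜ else 𝒜 j k) := by
    split_ifs
    · exact (h𝒜 j k hk).inter hBt.compl
    · exact h𝒜 j k hk
  have hreach := hP.measurable_apply_dirac_apply (measurableSet_FEv hB)
  have hpat : ∀ᵐ ρ ∂P μ, ρ ∈ ⋃ j : Fin m, GFPat (𝒜 j) (n j) := by
    have hmeas := MeasurableSet.iUnion fun j => measurableSet_GFPat (h𝒜 j)
    exact mem_ae_iff.2 ((prob_compl_eq_zero_iff hmeas).2 (h1 μ hμ))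
  have hU : MeasurableSet {s | ENNReal.ofReal (p / 2) ≤ P (Measure.dirac s) (FEv B)} :=
    measurableSet_le measurable_const hreach
  have hfreq (j : Fin m) := hP.ae_frequently_shiftRun_mem μ
    (measurableSet_piLE_Cyl (hA j))
    ((measurableSet_piLE_Cyl (hA j)).inter (measurable_piLE_eval le_rfl hU))
    (half_pos hp)
    fun s => hP.ofReal_half_mul_Cyl_le hB (hA j) hp s (h2 j _ inferInstance)
  filter_upwards [hpat, ae_all_iff.2 hfreq, hP.ae_mem_FEv_of_frequently μ hB (half_pos hp)]
    with ρ hρ hρfreq hρB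
  by_cases hρt : ρ ∈ FEv (Btilde P B)
  · exact Or.inr hρt
  obtain ⟨j, hj⟩ := mem_iUnion.1 hρ
  refine Or.inl (hρB ?_)
  have hD := hρfreq j (frequently_atTop.2 fun i => ?_)
  · exact (tendsto_add_atTop_nat (n j)).frequently (hD.mono fun t ht => ht.2)
  · obtain ⟨t, hit, ht⟩ := hj i
    refine ⟨t, hit, fun k hk => ?_⟩
    have hmem := ht k (Nat.lt_succ_iff.1 hk)
    dsimp only
    split_ifs
    · exact ⟨hmem, fun hk' => hρt ⟨t + k, hk'⟩⟩
    · exact hmem
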